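/- Let α = artanh(√2 − 1) = log(√(1+√2)), and let D_n be the set of triples (k, r, s) of positive integers with k odd, r > s, gcd(r, s) = 1, r and s of opposite parity, k·(r² − s²) ≤ n, and 2·k·r·s ≤ n. Then |D_n| ∼ (2α/π²)·n·log n as n → ∞, i.e. |D_n| / ((2α/π²)·n·log n) → 1. -/

import Mathlib

open Filter Real

theorem summable_moebius_div_sq :
    Summable fun d : ℕ => (ArithmeticFunction.moebius d : ℝ) / (d : ℝ) ^ 2 := by
  refine Summable.of_norm_bounded (Real.summable_one_div_nat_pow.mpr one_lt_two) fun d => ?_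
  rw [norm_div, Real.norm_eq_abs, norm_pow, Real.norm_natCast, ← Int.cast_abs]
  gcongr
  exact_mod_cast ArithmeticFunction.abs_moebius_le_one

theorem tsum_moebius_div_sq :
    ∑' d : ℕ, (ArithmeticFunction.moebius d : ℝ) / (d : ℝ) ^ 2 = 6 / π ^ 2 := by
  have h := ArithmeticFunction.LSeries_zeta_mul_Lseries_moebius (s := 2) (by simp)
  rw [ArithmeticFunction.LSeries_zeta_eq_riemannZeta (by simp), riemannZeta_two] at h
  have h2 : LSeries (fun n => (ArithmeticFunction.moebius n : ℂ)) 2 =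
      ((∑' d : ℕ, (ArithmeticFunction.moebius d : ℝ) / (d : ℝ) ^ 2 : ℝ) : ℂ) := by
    rw [LSeries, Complex.ofReal_tsum]
    refine tsum_congr fun d => ?_
    rcases eq_or_ne d 0 with rfl | hd
    · simp
    · rw [LSeries.term_of_ne_zero hd]
      norm_cast
  rw [h2] at h
  have h' : π ^ 2 / 6 * (∑' d : ℕ, (ArithmeticFunction.moebius d : ℝ) / (d : ℝ) ^ 2) = 1 := by
    exact_mod_cast h
  have := pi_ne_zero
  field_simp at h' ⊢
  linarith

theorem moebius_two_mul (d : ℕ) : ArithmeticFunction.moebius (2 * d) =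
    if Odd d then -ArithmeticFunction.moebius d else 0 := by
  split_ifs with h
  · rw [ArithmeticFunction.isMultiplicative_moebius.map_mul_of_coprime
      (Nat.coprime_two_left.mpr h), ArithmeticFunction.moebius_apply_prime Nat.prime_two]
    ring
  · refine ArithmeticFunction.moebius_eq_zero_of_not_squarefree fun hs => ?_
    obtain ⟨e, rfl⟩ := (Nat.not_odd_iff_even.mp h).two_dvd
    have := hs 2 ⟨e, by ring⟩
    simp at this

theorem tsum_odd_moebius_div_sq :
    ∑' d : ℕ, (if Odd d then (ArithmeticFunction.moebius d : ℝ) / (d : ℝ) ^ 2 else 0)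
      = 8 / π ^ 2 := by
  set f : ℕ → ℝ := fun d => (ArithmeticFunction.moebius d : ℝ) / (d : ℝ) ^ 2 with hf
  set g : ℕ → ℝ := fun d => if Odd d then f d else 0 with hg
  have hfs : Summable f := summable_moebius_div_sq
  have hgs : Summable g := by
    refine (hfs.indicator {d | Odd d}).congr fun d => ?_
    simp [hg, Set.indicator_apply]
  have h2 : (fun d => f (2 * d)) = fun d => -(1 / 4) * g d := by
    funext d
    simp only [hf, hg, moebius_two_mul]
    split_ifs <;> push_cast <;> ring
  have hinj : Function.Injective fun d : ℕ => 2 * d + 1 := fun a b h => by simpa using h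
  have hinj' : Function.Injective fun d : ℕ => 2 * d := fun a b h => by simpa using h
  have hF := tsum_even_add_odd (hfs.comp_injective hinj') (hfs.comp_injective hinj)
  have hG := tsum_even_add_odd (hgs.comp_injective hinj') (hgs.comp_injective hinj)
  have e1 : (fun d => g (2 * d)) = fun _ => 0 := by
    funext d; simp [hg]
  have e2 : (fun d => g (2 * d + 1)) = fun d => f (2 * d + 1) := by
    funext d; simp [hg]
  rw [e1, e2, tsum_zero] at hG
  rw [h2, tsum_mul_left, tsum_moebius_div_sq] at hF
  change ∑' d, g d = _
  have := pi_ne_zero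
  field_simp at hF ⊢
  linarith [congrArg (fun y => y * π ^ 2) hG]

theorem sum_moebius_divisors (n : ℕ) :
    ∑ d ∈ n.divisors, ArithmeticFunction.moebius d = if n = 1 then 1 else 0 := by
  rw [← ArithmeticFunction.coe_zeta_mul_apply, ArithmeticFunction.coe_zeta_mul_moebius,
    ArithmeticFunction.one_apply]

/-- The length of the horizontal section at height `t` of the region
`{(u, v) | 0 < v < u, u ^ 2 - v ^ 2 ≤ 1, 2 * u * v ≤ 1}`; the truncation at `1 / 4` does not
change its values and keeps the function monotone at `0`. -/
noncomputable def sectionLength (t : ℝ) : ℝ :=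
  max 0 (min (√(1 + t ^ 2) - t) (1 / (2 * max t (1 / 4)) - t))

theorem antitoneOn_sectionLength : AntitoneOn sectionLength (Set.Ici 0) := by
  intro a ha b hb hab
  simp only [Set.mem_Ici] at ha hb
  have hsqrt : √(1 + b ^ 2) - b ≤ √(1 + a ^ 2) - a := by
    have h1 : √(1 + b ^ 2) ≤ √(1 + a ^ 2) + (b - a) := by
      have h2 : a ≤ √(1 + a ^ 2) := le_sqrt_of_sq_le (by linarith)
      refine sqrt_le_iff.mpr ⟨by linarith, ?_⟩
      nlinarith [sq_sqrt (show 0 ≤ 1 + a ^ 2 by positivity)]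
    linarith
  unfold sectionLength
  gcongr max 0 (min ?_ ?_)
  have : 1 / (2 * max b (1 / 4)) ≤ 1 / (2 * max a (1 / 4)) := by gcongr
  linarith

theorem sectionLength_zero : sectionLength 0 = 1 := by
  norm_num [sectionLength]

theorem sectionLength_nonneg (t : ℝ) : 0 ≤ sectionLength t := le_max_left _ _

theorem sectionLength_eq_of_pos {t : ℝ} (ht : 0 < t) :
    sectionLength t = max 0 (min (√(1 + t ^ 2)) (1 / (2 * t)) - t) := by
  unfold sectionLength
  rw [← min_sub_sub_right]
  rcases le_total (1 / 4) t with h | h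
  · rw [max_eq_left h]
  · have h1 : √(1 + t ^ 2) ≤ 2 := sqrt_le_iff.mpr ⟨by norm_num, by nlinarith⟩
    have h2 : 2 ≤ 1 / (2 * t) := by rw [le_div_iff₀ (by positivity)]; linarith
    rw [max_eq_right h, min_eq_left (by linarith), min_eq_left (by linarith)]

theorem sectionLength_of_sq_le {t : ℝ} (ht : 0 < t) (h : t ^ 2 ≤ (√2 - 1) / 2) :
    sectionLength t = √(1 + t ^ 2) - t := by
  have h1 : √(1 + t ^ 2) ≤ 1 / (2 * t) := by
    rw [le_div_iff₀ (by positivity)]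
    have hs := sq_sqrt (show 0 ≤ 1 + t ^ 2 by positivity)
    have h2 := sq_sqrt (show (0 : ℝ) ≤ 2 by norm_num)
    refine (sq_le_sq₀ (by positivity) zero_le_one).mp ?_
    rw [mul_pow, hs]
    nlinarith [sqrt_nonneg 2]
  rw [sectionLength_eq_of_pos ht, min_eq_left h1, max_eq_right]
  exact sub_nonneg.mpr (le_sqrt_of_sq_le (by linarith))

theorem sectionLength_of_le_sq {t : ℝ} (ht : 0 < t) (h : (√2 - 1) / 2 ≤ t ^ 2)
    (h' : t ^ 2 ≤ 1 / 2) : sectionLength t = 1 / (2 * t) - t := by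
  have h1 : 1 / (2 * t) ≤ √(1 + t ^ 2) := by
    refine le_sqrt_of_sq_le ?_
    rw [div_pow, div_le_iff₀ (by positivity)]
    have h2 := sq_sqrt (show (0 : ℝ) ≤ 2 by norm_num)
    nlinarith [sqrt_nonneg 2]
  rw [sectionLength_eq_of_pos ht, min_eq_right h1, max_eq_right]
  rw [sub_nonneg, le_div_iff₀ (by positivity)]
  linarith

theorem sectionLength_of_half_le_sq {t : ℝ} (ht : 0 < t) (h : 1 / 2 ≤ t ^ 2) :
    sectionLength t = 0 := by
  rw [sectionLength_eq_of_pos ht]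
  have h2 : 1 / (2 * t) ≤ t := by rw [div_le_iff₀ (by positivity)]; linarith
  exact max_eq_left (by linarith [min_le_right (√(1 + t ^ 2)) (1 / (2 * t))])

theorem intervalIntegrable_sectionLength {a b : ℝ} (ha : 0 ≤ a) (hb : 0 ≤ b) :
    IntervalIntegrable sectionLength MeasureTheory.volume a b :=
  (antitoneOn_sectionLength.mono fun _ hx => (le_min ha hb).trans hx.1).intervalIntegrable

theorem integral_sectionLength {b : ℝ} (hb : 1 ≤ b) :
    ∫ t in (0)..b, sectionLength t = log (√(1 + √2)) := by
  have hq := sq_sqrt (show (0 : ℝ) ≤ 2 by norm_num)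
  have hq1 : 1 < √2 := by rw [lt_sqrt] <;> norm_num
  have hq2 : √2 < 3 / 2 := by rw [sqrt_lt'] <;> norm_num
  set p : ℝ := √((√2 - 1) / 2) with hp
  set q : ℝ := √(1 / 2) with hqd
  have hp2 : p ^ 2 = (√2 - 1) / 2 := sq_sqrt (by linarith)
  have hq2' : q ^ 2 = 1 / 2 := sq_sqrt (by norm_num)
  have hp0 : 0 < p := sqrt_pos.mpr (by linarith)
  have hpq : p < q := sqrt_lt_sqrt (by linarith) (by linarith)
  have hq0 : 0 < q := hp0.trans hpq
  have hqb : q ≤ b := by nlinarith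
  have i1 : ∫ t in (0)..p, sectionLength t =
      (p * √(1 + p ^ 2) + arsinh p - p ^ 2) / 2 := by
    have : ∫ t in (0)..p, sectionLength t = ∫ t in (0)..p, (√(1 + t ^ 2) - t) := by
      refine intervalIntegral.integral_congr_ae (Eventually.of_forall fun t ht => ?_)
      rw [Set.uIoc_of_le hp0.le] at ht
      exact sectionLength_of_sq_le ht.1 (by nlinarith [ht.1, ht.2])
    rw [this, intervalIntegral.integral_eq_sub_of_hasDerivAt
      (f := fun t => (t * √(1 + t ^ 2) + arsinh t - t ^ 2) / 2)]
    · simp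
    · intro t _
      have h0 : 0 < 1 + t ^ 2 := by positivity
      have hd := ((((hasDerivAt_id t).mul (((hasDerivAt_pow 2 t).const_add 1).sqrt h0.ne')).add
        (hasDerivAt_arsinh t)).sub (hasDerivAt_pow 2 t)).div_const 2
      refine hd.congr_deriv ?_
      have hs := sqrt_pos.mpr h0
      have hs2 := sq_sqrt h0.le
      simp only [id]
      field_simp
      push_cast
      linear_combination (-2) * hs2
    · exact (by fun_prop : Continuous fun t : ℝ => √(1 + t ^ 2) - t).intervalIntegrable _ _
  have i2 : ∫ t in p..q, sectionLength t =
      (log q - q ^ 2) / 2 - (log p - p ^ 2) / 2 := by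
    have : ∫ t in p..q, sectionLength t = ∫ t in p..q, (1 / (2 * t) - t) := by
      refine intervalIntegral.integral_congr_ae (Eventually.of_forall fun t ht => ?_)
      rw [Set.uIoc_of_le hpq.le] at ht
      exact sectionLength_of_le_sq (hp0.trans ht.1) (by nlinarith [ht.1, ht.2])
        (by nlinarith [ht.1, ht.2])
    have hne : ∀ t ∈ Set.uIcc p q, t ≠ 0 := fun t ht => by
      rw [Set.uIcc_of_le hpq.le] at ht
      exact (hp0.trans_le ht.1).ne'
    rw [this, intervalIntegral.integral_eq_sub_of_hasDerivAt
      (f := fun t => (log t - t ^ 2) / 2)]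
    · intro t ht
      have hd := ((hasDerivAt_log (hne t ht)).sub (hasDerivAt_pow 2 t)).div_const 2
      refine hd.congr_deriv ?_
      have := hne t ht
      field_simp
      push_cast
      ring
    · refine ContinuousOn.intervalIntegrable ?_
      refine ContinuousOn.sub (ContinuousOn.div (by fun_prop) (by fun_prop) ?_) (by fun_prop)
      exact fun t ht => mul_ne_zero two_ne_zero (hne t ht)
  have i3 : ∫ t in q..b, sectionLength t = 0 := by
    rw [intervalIntegral.integral_congr_ae (g := fun _ => 0), intervalIntegral.integral_zero]
    refine Eventually.of_forall fun t ht => ?_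
    rw [Set.uIoc_of_le hqb] at ht
    exact sectionLength_of_half_le_sq (hq0.trans ht.1) (by nlinarith [ht.1])
  have int {a c : ℝ} := @intervalIntegrable_sectionLength a c
  rw [← intervalIntegral.integral_add_adjacent_intervals (int le_rfl hq0.le)
    (int hq0.le (by linarith)), ← intervalIntegral.integral_add_adjacent_intervals
    (int le_rfl hp0.le) (int hp0.le hq0.le), i1, i2, i3]
  have hps : p * √(1 + p ^ 2) = 1 / 2 := by
    rw [hp2, hp, ← sqrt_mul (by linarith),
      show (√2 - 1) / 2 * (1 + (√2 - 1) / 2) = (1 / 2) ^ 2 by nlinarith,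
      sqrt_sq (by norm_num)]
  have har : arsinh p + log q - log p = log (1 + √2) := by
    have h0 : 0 < √(1 + p ^ 2) := by positivity
    rw [arsinh, ← log_mul (by positivity) hq0.ne', ← log_div (by positivity) hp0.ne']
    have hpp : √(1 + p ^ 2) = (1 + √2) * p := by
      have : √(1 + p ^ 2) * p ^ 2 = (1 + √2) * p * p ^ 2 := by
        calc √(1 + p ^ 2) * p ^ 2 = p * (p * √(1 + p ^ 2)) := by ring
          _ = (1 + √2) * p * p ^ 2 := by rw [hps, hp2]; nlinarith
      exact mul_right_cancel₀ (by positivity) this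
    have hqq : q = √2 / 2 := by
      rw [hqd, sqrt_eq_iff_mul_self_eq] <;> nlinarith
    rw [hpp, hqq]
    congr 1
    field_simp
    nlinarith
  rw [log_sqrt (x := 1 + √2) (by positivity), ← har, hps, hp2, hq2']
  ring

/-- The pairs `(r, s)` with `0 < s < r` of opposite parity whose Pythagorean triple
`(r ^ 2 - s ^ 2, 2 * r * s, r ^ 2 + s ^ 2)` has both legs at most `x`. -/
noncomputable def legPairs (x : ℝ) : Finset (ℕ × ℕ) :=
  (Finset.range (⌊x⌋₊ + 1) ×ˢ Finset.range (⌊x⌋₊ + 1)).filter fun p =>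
    0 < p.2 ∧ p.2 < p.1 ∧ Odd (p.1 + p.2) ∧
      (p.1 : ℝ) ^ 2 - (p.2 : ℝ) ^ 2 ≤ x ∧ 2 * (p.1 : ℝ) * p.2 ≤ x

theorem mem_legPairs {x : ℝ} {p : ℕ × ℕ} : p ∈ legPairs x ↔
    0 < p.2 ∧ p.2 < p.1 ∧ Odd (p.1 + p.2) ∧
      (p.1 : ℝ) ^ 2 - (p.2 : ℝ) ^ 2 ≤ x ∧ 2 * (p.1 : ℝ) * p.2 ≤ x := by
  simp only [legPairs, Finset.mem_filter, Finset.mem_product, Finset.mem_range,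
    Nat.lt_succ_iff, and_iff_right_iff_imp]
  rintro ⟨h0, h1, -, -, h2⟩
  have hs : (1 : ℝ) ≤ p.2 := by exact_mod_cast h0
  have hr : (p.2 : ℝ) ≤ p.1 := by exact_mod_cast h1.le
  exact ⟨Nat.le_floor (by nlinarith), Nat.le_floor (by nlinarith)⟩

theorem fst_le_of_mem_legPairs {x : ℝ} {p : ℕ × ℕ} (hp : p ∈ legPairs x) : (p.1 : ℝ) ≤ x := by
  obtain ⟨h0, -, -, -, h2⟩ := mem_legPairs.mp hp
  have hs : (1 : ℝ) ≤ p.2 := by exact_mod_cast h0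
  nlinarith [(Nat.cast_nonneg p.1 : (0 : ℝ) ≤ p.1)]

theorem legPairs_eq_empty {x : ℝ} (hx : x < 1) : legPairs x = ∅ := by
  refine Finset.eq_empty_of_forall_notMem fun p hp => ?_
  have h := fst_le_of_mem_legPairs hp
  obtain ⟨h0, h1, -⟩ := mem_legPairs.mp hp
  have : (1 : ℝ) ≤ p.1 := by exact_mod_cast (by omega : 1 ≤ p.1)
  linarith

theorem card_legPairs_fiber {x : ℝ} (hx : 0 ≤ x) {s : ℕ} (hs : 0 < s) :
    ((legPairs x).filter fun p => p.2 = s).card =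
      ⌊(min (√(x + (s : ℝ) ^ 2)) (x / (2 * s)) - s + 1) / 2⌋₊ := by
  set b : ℝ := min (√(x + (s : ℝ) ^ 2)) (x / (2 * s)) with hb
  have hs' : (0 : ℝ) < s := by exact_mod_cast hs
  have hle (r : ℕ) : ((r : ℝ) ^ 2 - (s : ℝ) ^ 2 ≤ x ∧ 2 * (r : ℝ) * s ≤ x) ↔ (r : ℝ) ≤ b := by
    rw [hb, le_min_iff, le_sqrt (by positivity), le_div_iff₀ (by positivity), sub_le_iff_le_add,
      mul_left_comm, mul_assoc]
    positivity
  rw [← Finset.card_range ⌊(b - s + 1) / 2⌋₊]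
  symm
  refine Finset.card_bij (fun j _ => (s + 2 * j + 1, s)) ?_ ?_ ?_
  · intro j hj
    rw [Finset.mem_range, Nat.lt_iff_add_one_le, Nat.le_floor_iff' (by omega)] at hj
    push_cast at hj
    refine Finset.mem_filter.mpr ⟨mem_legPairs.mpr ⟨hs, by dsimp only; omega,
      ⟨s + j, by dsimp only; ring⟩, (hle _).mpr ?_⟩, rfl⟩
    push_cast
    linarith
  · intro i _ j _ h
    simp only [Prod.mk.injEq, and_true] at h
    omega
  · rintro ⟨r, s'⟩ h
    obtain ⟨hmem, rfl⟩ := Finset.mem_filter.mp h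
    obtain ⟨-, h1, ⟨m, hm⟩, h3⟩ := mem_legPairs.mp hmem
    have h3 := (hle r).mp h3
    dsimp only at *
    obtain ⟨j, rfl⟩ : ∃ j, r = s' + 2 * j + 1 := ⟨m - s', by omega⟩
    refine ⟨j, ?_, rfl⟩
    rw [Finset.mem_range, Nat.lt_iff_add_one_le, Nat.le_floor_iff' (by omega)]
    push_cast at h3 ⊢
    linarith

theorem sqrt_mul_sectionLength {x t : ℝ} (hx : 0 < x) (ht : 0 < t) :
    √x * sectionLength (t / √x) = max 0 (min (√(x + t ^ 2)) (x / (2 * t)) - t) := by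
  have hs := sqrt_pos.mpr hx
  have hq := sq_sqrt hx.le
  rw [sectionLength_eq_of_pos (by positivity), mul_max_of_nonneg _ _ hs.le, mul_zero, mul_sub,
    mul_min_of_nonneg _ _ hs.le, ← sqrt_mul hx.le]
  congr 3
  · rw [div_pow, hq]
    field_simp
  · field_simp
    linarith
  · field_simp

theorem abs_floor_sub_le (y : ℝ) : |(⌊(y + 1) / 2⌋₊ : ℝ) - max 0 y / 2| ≤ 1 / 2 := by
  rcases lt_or_ge y 0 with h | h
  · rw [Nat.floor_eq_zero.mpr (by linarith), max_eq_left h.le]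
    norm_num
  · rw [max_eq_right h, abs_le]
    have h1 := Nat.floor_le (show 0 ≤ (y + 1) / 2 by linarith)
    have h2 := Nat.lt_floor_add_one ((y + 1) / 2)
    constructor <;> linarith

theorem abs_sum_sectionLength_sub_le {x : ℝ} (hx : 0 < x) :
    |∑ i ∈ Finset.range ⌈√x⌉₊, √x * sectionLength (((i + 1 : ℕ) : ℝ) / √x)
      - log (√(1 + √2)) * x| ≤ √x := by
  have hs := sqrt_pos.mpr hx
  set N := ⌈√x⌉₊
  set F : ℝ → ℝ := fun t => √x * sectionLength (t / √x) with hF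
  have hanti : AntitoneOn F (Set.Icc (0 : ℝ) (0 + N)) := by
    intro a ha b hb hab
    refine mul_le_mul_of_nonneg_left (antitoneOn_sectionLength ?_ ?_ ?_) hs.le
    · exact div_nonneg ha.1 hs.le
    · exact div_nonneg hb.1 hs.le
    · gcongr
  have hint : ∫ t in (0 : ℝ)..(0 + N), F t = log (√(1 + √2)) * x := by
    rw [hF, intervalIntegral.integral_const_mul, intervalIntegral.integral_comp_div _ hs.ne',
      zero_div, zero_add, integral_sectionLength ((one_le_div hs).mpr (Nat.le_ceil _)),
      smul_eq_mul, ← mul_assoc, mul_self_sqrt hx.le, mul_comm]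
  have h1 := hanti.sum_le_integral
  have h2 := hanti.integral_le_sum
  rw [hint] at h1 h2
  simp only [zero_add] at h1 h2
  have h3 := Finset.sum_range_succ (fun i : ℕ => F i) N
  rw [Finset.sum_range_succ'] at h3
  have hF0 : F ((0 : ℕ) : ℝ) = √x := by simp [hF, sectionLength_zero]
  have hFN : 0 ≤ F (N : ℝ) := mul_nonneg hs.le (sectionLength_nonneg _)
  rw [hF0] at h3
  change |∑ i ∈ Finset.range N, F ((i + 1 : ℕ) : ℝ) - _| ≤ _
  rw [abs_le]
  constructor <;> linarith

theorem abs_card_legPairs_sub_le {x : ℝ} (hx : 1 ≤ x) :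
    |((legPairs x).card : ℝ) - log (√(1 + √2)) / 2 * x| ≤ 2 * √x := by
  have hx0 : 0 < x := by linarith
  have hs1 : 1 ≤ √x := one_le_sqrt.mpr hx
  have hq := sq_sqrt hx0.le
  set N := ⌈√x⌉₊ with hN
  have hcard : (legPairs x).card =
      ∑ i ∈ Finset.range N, ((legPairs x).filter fun p => p.2 = i + 1).card := by
    rw [Finset.card_eq_sum_card_fiberwise (f := fun p => p.2 - 1) (t := Finset.range N)]
    · refine Finset.sum_congr rfl fun i _ => ?_
      congr 1
      refine Finset.filter_congr fun p hp => ?_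
      have := (mem_legPairs.mp hp).1
      omega
    · intro p hp
      obtain ⟨h0, h1, -, -, h2⟩ := mem_legPairs.mp hp
      have h1' : (p.2 : ℝ) ≤ p.1 := by exact_mod_cast h1.le
      have h3 : (p.2 : ℝ) ≤ √x := le_sqrt_of_sq_le (by nlinarith)
      have h4 : p.2 ≤ N := by exact_mod_cast h3.trans (Nat.le_ceil _)
      simp only [Finset.coe_range, Set.mem_Iio]
      omega
  have hterm : ∀ i ∈ Finset.range N, |(((legPairs x).filter fun p => p.2 = i + 1).card : ℝ)
      - √x * sectionLength (((i + 1 : ℕ) : ℝ) / √x) / 2| ≤ 1 / 2 := by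
    intro i _
    rw [card_legPairs_fiber hx0.le i.succ_pos, sqrt_mul_sectionLength hx0 (by positivity)]
    exact abs_floor_sub_le _
  have hsum : |((legPairs x).card : ℝ)
      - (∑ i ∈ Finset.range N, √x * sectionLength (((i + 1 : ℕ) : ℝ) / √x)) / 2| ≤ N * (1 / 2) := by
    rw [hcard, Finset.sum_div, Nat.cast_sum, ← Finset.sum_sub_distrib]
    refine (Finset.abs_sum_le_sum_abs _ _).trans ((Finset.sum_le_sum hterm).trans ?_)
    simp
  have hNle : (N : ℝ) ≤ √x + 1 := (Nat.ceil_lt_add_one (by positivity)).le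
  have hI := abs_sum_sectionLength_sub_le hx0
  rw [abs_le] at *
  constructor <;> linarith [hsum.1, hsum.2, hI.1, hI.2]

/-- The number of triples `(k, r, s)` with `k` odd, `0 < s < r`, and `r`, `s` of opposite parity,
such that `k * (r ^ 2 - s ^ 2) ≤ x` and `2 * k * r * s ≤ x`. -/
noncomputable def tripleCount (x : ℝ) : ℝ :=
  ∑ j ∈ Finset.range ((⌊x⌋₊ + 1) / 2), ((legPairs (x / (2 * j + 1))).card : ℝ)

theorem sum_range_card_legPairs {x : ℝ} {N : ℕ} (h : x ≤ N) (hx : 0 ≤ x) :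
    ∑ j ∈ Finset.range ((N + 1) / 2), ((legPairs (x / (2 * j + 1))).card : ℝ) =
      tripleCount x := by
  have hN : ⌊x⌋₊ ≤ N := Nat.floor_le_of_le h
  refine (Finset.sum_subset (Finset.range_mono (by omega)) fun j _ hj => ?_).symm
  rw [Finset.mem_range, not_lt] at hj
  rw [legPairs_eq_empty, Finset.card_empty, Nat.cast_zero]
  rw [div_lt_one (by positivity)]
  have := (Nat.floor_lt hx).mp (show ⌊x⌋₊ < 2 * j + 1 by omega)
  exact_mod_cast this

theorem tripleCount_eq_zero {x : ℝ} (hx : x < 1) : tripleCount x = 0 := by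
  simp [tripleCount, Nat.floor_eq_zero.mpr hx]

theorem tripleCount_nonneg (x : ℝ) : 0 ≤ tripleCount x :=
  Finset.sum_nonneg fun _ _ => Nat.cast_nonneg _

theorem log_le_sum_inv_odd (M : ℕ) :
    log (2 * M + 1) / 2 ≤ ∑ j ∈ Finset.range M, 1 / (2 * (j : ℝ) + 1) := by
  induction M with
  | zero => simp
  | succ M ih =>
    rw [Finset.sum_range_succ]
    have h0 : (0 : ℝ) < 2 * M + 1 := by positivity
    have h1 := log_le_sub_one_of_pos (show (0 : ℝ) < (2 * M + 3) / (2 * M + 1) by positivity)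
    rw [log_div (by positivity) (by positivity)] at h1
    have h2 : (2 * (M : ℝ) + 3) / (2 * M + 1) - 1 = 2 * (1 / (2 * M + 1)) := by
      field_simp
      ring
    push_cast
    rw [show 2 * ((M : ℝ) + 1) + 1 = 2 * M + 3 by ring]
    linarith

theorem sum_inv_odd_le_log (M : ℕ) :
    ∑ j ∈ Finset.range (M + 1), 1 / (2 * (j : ℝ) + 1) ≤ 1 + log (2 * M + 1) / 2 := by
  induction M with
  | zero => simp
  | succ M ih =>
    rw [Finset.sum_range_succ]
    have h1 := log_le_sub_one_of_pos (show (0 : ℝ) < (2 * M + 1) / (2 * M + 3) by positivity)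
    rw [log_div (by positivity) (by positivity)] at h1
    have h2 : (2 * (M : ℝ) + 1) / (2 * M + 3) - 1 = - (2 * (1 / (2 * M + 3))) := by
      field_simp
      ring
    push_cast
    rw [show 2 * ((M : ℝ) + 1) + 1 = 2 * M + 3 by ring]
    linarith

theorem sum_inv_sqrt_le (M : ℕ) :
    ∑ j ∈ Finset.range M, 1 / √(2 * (j : ℝ) + 1) ≤ 2 * √M := by
  induction M with
  | zero => simp
  | succ M ih =>
    rw [Finset.sum_range_succ]
    have hm : (0 : ℝ) ≤ M := M.cast_nonneg
    have h1 : √((M : ℝ) + 1) ≤ √(2 * (M : ℝ) + 1) := sqrt_le_sqrt (by linarith)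
    have h2 : 0 < √((M : ℝ) + 1) := by positivity
    have h3 : 1 / √(2 * (M : ℝ) + 1) ≤ 1 / √((M : ℝ) + 1) := by gcongr
    have h4 : 1 / √((M : ℝ) + 1) ≤ 2 * √((M : ℝ) + 1) - 2 * √M := by
      rw [div_le_iff₀ h2]
      nlinarith [sq_sqrt hm, sq_sqrt (show (0 : ℝ) ≤ M + 1 by linarith),
        sq_nonneg (√((M : ℝ) + 1) - √M)]
    push_cast
    linarith

theorem log_sqrt_one_add_sqrt_two_pos : 0 < log (√(1 + √2)) := by
  refine log_pos ?_
  rw [lt_sqrt zero_le_one]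
  linarith [sqrt_pos.mpr (show (0 : ℝ) < 2 by norm_num)]

theorem abs_tripleCount_sub_le {x : ℝ} (hx : 1 ≤ x) :
    |tripleCount x - log (√(1 + √2)) / 4 * (x * log x)| ≤
      (4 + log (√(1 + √2)) / 2) * x := by
  have hx0 : 0 < x := by linarith
  set a := log (√(1 + √2)) with ha
  have ha0 : 0 < a := log_sqrt_one_add_sqrt_two_pos
  have hf1 : 1 ≤ ⌊x⌋₊ := Nat.one_le_floor_iff _ |>.mpr hx
  have hfle : (⌊x⌋₊ : ℝ) ≤ x := Nat.floor_le hx0.le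
  obtain ⟨M, hM⟩ : ∃ M, (⌊x⌋₊ + 1) / 2 = M + 1 := ⟨(⌊x⌋₊ + 1) / 2 - 1, by omega⟩
  have hub : 2 * (M : ℝ) + 1 ≤ x := by
    refine le_trans ?_ hfle
    exact_mod_cast (by omega : 2 * M + 1 ≤ ⌊x⌋₊)
  have hlb : x ≤ 2 * ((M + 1 : ℕ) : ℝ) + 1 := by
    refine (Nat.lt_floor_add_one x).le.trans ?_
    exact_mod_cast (by omega : ⌊x⌋₊ + 1 ≤ 2 * (M + 1) + 1)
  set O := ∑ j ∈ Finset.range (M + 1), 1 / (2 * (j : ℝ) + 1) with hO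
  have hO1 : log x / 2 ≤ O := by
    have := log_le_log hx0 hlb
    linarith [log_le_sum_inv_odd (M + 1)]
  have hO2 : O ≤ 1 + log x / 2 := by
    have := log_le_log (by positivity) hub
    linarith [sum_inv_odd_le_log M]
  have hmain : |tripleCount x - a / 2 * x * O| ≤ 4 * x := by
    rw [tripleCount, hM, hO, Finset.mul_sum, ← Finset.sum_sub_distrib]
    have hterm : ∀ j ∈ Finset.range (M + 1),
        |((legPairs (x / (2 * j + 1))).card : ℝ) - a / 2 * x * (1 / (2 * (j : ℝ) + 1))| ≤
          2 * √x * (1 / √(2 * (j : ℝ) + 1)) := by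
      intro j hj
      have hjM : (j : ℝ) ≤ M := by exact_mod_cast Nat.lt_succ_iff.mp (Finset.mem_range.mp hj)
      have h := abs_card_legPairs_sub_le (x := x / (2 * j + 1))
        ((one_le_div (by positivity)).mpr (by linarith))
      rw [sqrt_div hx0.le] at h
      convert h using 1
      · congr 2; ring
      · ring
    refine (Finset.abs_sum_le_sum_abs _ _).trans ((Finset.sum_le_sum hterm).trans ?_)
    rw [← Finset.mul_sum]
    have h1 := sum_inv_sqrt_le (M + 1)
    have h2 : √((M + 1 : ℕ) : ℝ) ≤ √x := sqrt_le_sqrt (by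
      refine le_trans ?_ hfle
      exact_mod_cast (by omega : M + 1 ≤ ⌊x⌋₊))
    calc _ ≤ 2 * √x * (2 * √x) := by gcongr; linarith
      _ = 4 * x := by nlinarith [sq_sqrt hx0.le]
  have h3 : |a / 2 * x * O - a / 4 * (x * log x)| ≤ a / 2 * x := by
    have hax : 0 < a / 2 * x := by positivity
    rw [abs_le]
    constructor <;> nlinarith
  calc _ ≤ |tripleCount x - a / 2 * x * O| + |a / 2 * x * O - a / 4 * (x * log x)| :=
        abs_sub_le _ _ _
    _ ≤ _ := by linarith

theorem card_filter_dvd_legPairs (x : ℝ) {d : ℕ} (hd : Odd d) :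
    ((legPairs x).filter fun p => d ∣ p.1 ∧ d ∣ p.2).card =
      (legPairs (x / (d : ℝ) ^ 2)).card := by
  have hd0 : 0 < d := hd.pos
  have hd' : (0 : ℝ) < d := by exact_mod_cast hd0
  have key (r s : ℕ) : (d * r, d * s) ∈ legPairs x ↔ (r, s) ∈ legPairs (x / (d : ℝ) ^ 2) := by
    simp only [mem_legPairs, ← mul_add, Nat.odd_mul, hd, true_and, Nat.cast_mul,
      mul_lt_mul_iff_right₀ hd0, mul_pos_iff_of_pos_left hd0]
    rw [le_div_iff₀ (by positivity), le_div_iff₀ (by positivity),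
      show ((d : ℝ) * r) ^ 2 - (d * s) ^ 2 = ((r : ℝ) ^ 2 - s ^ 2) * d ^ 2 by ring,
      show 2 * ((d : ℝ) * r) * (d * s) = 2 * (r : ℝ) * s * d ^ 2 by ring]
  symm
  refine Finset.card_bij (fun p _ => (d * p.1, d * p.2)) ?_ ?_ ?_
  · rintro ⟨r, s⟩ h
    exact Finset.mem_filter.mpr ⟨(key r s).mpr h, dvd_mul_right _ _, dvd_mul_right _ _⟩
  · rintro ⟨r, s⟩ _ ⟨r', s'⟩ _ h
    simpa [hd0.ne'] using h
  · rintro ⟨r, s⟩ h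
    obtain ⟨hmem, ⟨r', rfl⟩, ⟨s', rfl⟩⟩ := Finset.mem_filter.mp h
    exact ⟨(r', s'), (key r' s').mp hmem, rfl⟩

theorem card_filter_dvd_legPairs_of_even (x : ℝ) {d : ℕ} (hd : ¬ Odd d) :
    ((legPairs x).filter fun p => d ∣ p.1 ∧ d ∣ p.2).card = 0 := by
  rw [Finset.card_eq_zero, Finset.filter_eq_empty_iff]
  rintro p hp ⟨h1, h2⟩
  have h3 := (Nat.not_odd_iff_even.mp hd).two_dvd.trans (dvd_add h1 h2)
  exact Nat.not_even_iff_odd.mpr (mem_legPairs.mp hp).2.2.1 (even_iff_two_dvd.mpr h3)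

theorem card_coprime_legPairs {x : ℝ} {N : ℕ} (hN : x ≤ N) :
    (((legPairs x).filter fun p => Nat.Coprime p.1 p.2).card : ℝ) =
      ∑ d ∈ Finset.range (N + 1), if Odd d then
        (ArithmeticFunction.moebius d : ℝ) * ((legPairs (x / (d : ℝ) ^ 2)).card : ℝ) else 0 := by
  have h1 : ∀ p ∈ legPairs x, (if Nat.Coprime p.1 p.2 then 1 else 0 : ℤ) =
      ∑ d ∈ Finset.range (N + 1),
        if d ∣ p.1 ∧ d ∣ p.2 then ArithmeticFunction.moebius d else 0 := by
    intro p hp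
    have hp1 : 0 < p.1 := by have := mem_legPairs.mp hp; omega
    have hpN : p.1 ≤ N := by exact_mod_cast (fst_le_of_mem_legPairs hp).trans hN
    have hg : Nat.gcd p.1 p.2 ≠ 0 := Nat.gcd_ne_zero_left hp1.ne'
    rw [show (if Nat.Coprime p.1 p.2 then 1 else 0 : ℤ) = if Nat.gcd p.1 p.2 = 1 then 1 else 0 from
      if_congr Iff.rfl rfl rfl, ← sum_moebius_divisors, ← Finset.sum_filter]
    refine Finset.sum_congr (Finset.ext fun d => ?_) fun _ _ => rfl
    simp only [Nat.mem_divisors, Finset.mem_filter, Finset.mem_range, Nat.dvd_gcd_iff, hg, ne_eq,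
      not_false_eq_true, and_true]
    exact ⟨fun h => ⟨by have := Nat.le_of_dvd hp1 h.1; omega, h⟩, fun h => h.2⟩
  have h2 : (((legPairs x).filter fun p => Nat.Coprime p.1 p.2).card : ℤ) =
      ∑ d ∈ Finset.range (N + 1), if Odd d then
        ArithmeticFunction.moebius d * ((legPairs (x / (d : ℝ) ^ 2)).card : ℤ) else 0 := by
    rw [Finset.card_filter]
    push_cast
    rw [Finset.sum_congr rfl h1, Finset.sum_comm]
    refine Finset.sum_congr rfl fun d _ => ?_
    rw [← Finset.sum_filter, Finset.sum_const, nsmul_eq_mul, mul_comm]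
    split_ifs with hd
    · rw [card_filter_dvd_legPairs x hd]
    · rw [card_filter_dvd_legPairs_of_even x hd, Nat.cast_zero, mul_zero]
  have h3 := congrArg (Int.cast : ℤ → ℝ) h2
  push_cast [apply_ite] at h3
  exact h3

theorem ncard_eq_sum (n : ℕ) :
    {t : ℕ × ℕ × ℕ | 0 < t.1 ∧ Odd t.1 ∧ t.2.2 < t.2.1 ∧ 0 < t.2.2 ∧
      Nat.Coprime t.2.1 t.2.2 ∧ t.2.1 % 2 ≠ t.2.2 % 2 ∧
      t.1 * (t.2.1 ^ 2 - t.2.2 ^ 2) ≤ n ∧ 2 * t.1 * t.2.1 * t.2.2 ≤ n}.ncard =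
    ∑ j ∈ Finset.range ((n + 1) / 2),
      ((legPairs ((n : ℝ) / (2 * j + 1))).filter fun p => Nat.Coprime p.1 p.2).card := by
  rw [← Finset.card_sigma]
  set S := (Finset.range ((n + 1) / 2)).sigma fun j =>
    (legPairs ((n : ℝ) / (2 * j + 1))).filter fun p => Nat.Coprime p.1 p.2 with hS
  have hinj : Function.Injective fun q : (_ : ℕ) × (ℕ × ℕ) => (2 * q.1 + 1, q.2) := by
    rintro ⟨i, p⟩ ⟨j, q⟩ h
    simp only [Prod.mk.injEq, Nat.add_right_cancel_iff] at h
    obtain ⟨h1, rfl⟩ := h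
    obtain rfl : i = j := by omega
    rfl
  rw [← Set.ncard_coe_finset S, ← Set.ncard_image_of_injective _ hinj]
  congr 1
  have key (j r s : ℕ) (hsr : s < r) :
      ((r : ℝ) ^ 2 - (s : ℝ) ^ 2 ≤ (n : ℝ) / (2 * j + 1) ∧
        2 * (r : ℝ) * s ≤ (n : ℝ) / (2 * j + 1)) ↔
      ((2 * j + 1) * (r ^ 2 - s ^ 2) ≤ n ∧ 2 * (2 * j + 1) * r * s ≤ n) := by
    rw [le_div_iff₀ (by positivity), le_div_iff₀ (by positivity)]
    have h : s ^ 2 ≤ r ^ 2 := Nat.pow_le_pow_left hsr.le 2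
    rw [← Nat.cast_le (α := ℝ), ← Nat.cast_le (α := ℝ)]
    push_cast [Nat.cast_sub h]
    rw [mul_comm (2 * (j : ℝ) + 1),
      show 2 * (2 * (j : ℝ) + 1) * r * s = 2 * r * s * (2 * j + 1) by ring]
  ext ⟨k, r, s⟩
  simp only [Set.mem_ofPred_eq, Set.mem_image, Finset.mem_coe, hS, Finset.mem_sigma,
    Finset.mem_range, Finset.mem_filter, mem_legPairs, Sigma.exists, Prod.mk.injEq]
  constructor
  · rintro ⟨-, ⟨j, rfl⟩, hsr, hs, hc, hpar, h⟩
    refine ⟨j, (r, s), ⟨?_, ⟨hs, hsr, ?_, (key j r s hsr).mpr h⟩, hc⟩, rfl, rfl⟩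
    · have h1 : 1 ≤ r * s := Nat.mul_pos (by omega) hs
      have : 2 * j + 1 ≤ n := by nlinarith [h.2]
      omega
    · rw [Nat.odd_iff]
      dsimp only
      omega
  · rintro ⟨j, p, ⟨-, ⟨hs, hsr, hpar, h⟩, hc⟩, rfl, rfl⟩
    refine ⟨by omega, ⟨j, rfl⟩, hsr, hs, hc, ?_, (key j _ _ hsr).mp h⟩
    rw [Nat.odd_iff] at hpar
    dsimp only at *
    omega

theorem ncard_eq_tsum (n : ℕ) :
    ({t : ℕ × ℕ × ℕ | 0 < t.1 ∧ Odd t.1 ∧ t.2.2 < t.2.1 ∧ 0 < t.2.2 ∧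
      Nat.Coprime t.2.1 t.2.2 ∧ t.2.1 % 2 ≠ t.2.2 % 2 ∧
      t.1 * (t.2.1 ^ 2 - t.2.2 ^ 2) ≤ n ∧ 2 * t.1 * t.2.1 * t.2.2 ≤ n}.ncard : ℝ) =
    ∑' d : ℕ, if Odd d then
      (ArithmeticFunction.moebius d : ℝ) * tripleCount ((n : ℝ) / (d : ℝ) ^ 2) else 0 := by
  rw [tsum_eq_sum (s := Finset.range (n + 1)), ncard_eq_sum, Nat.cast_sum]
  · have hle (j : ℕ) : (n : ℝ) / (2 * j + 1) ≤ n :=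
      div_le_self n.cast_nonneg (by linarith [(Nat.cast_nonneg j : (0 : ℝ) ≤ j)])
    rw [Finset.sum_congr rfl fun j _ => card_coprime_legPairs (hle j), Finset.sum_comm]
    refine Finset.sum_congr rfl fun d _ => ?_
    split_ifs with hd
    · have hd1 : (1 : ℝ) ≤ (d : ℝ) ^ 2 := one_le_pow₀ (by exact_mod_cast hd.pos)
      rw [← sum_range_card_legPairs (div_le_self n.cast_nonneg hd1) (by positivity),
        Finset.mul_sum]
      refine Finset.sum_congr rfl fun j _ => ?_
      rw [div_right_comm]
    · simp
  · intro d hd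
    rw [Finset.mem_range, not_lt] at hd
    have h1 : (n : ℝ) + 1 ≤ d := by exact_mod_cast hd
    rw [tripleCount_eq_zero, mul_zero, ite_self]
    have h0 : (0 : ℝ) ≤ n := n.cast_nonneg
    rw [div_lt_one (by nlinarith)]
    nlinarith

theorem tendsto_tripleCount_div {c : ℝ} (hc : 0 < c) :
    Tendsto (fun n : ℕ => tripleCount ((n : ℝ) / c) / ((n : ℝ) * log n)) atTop
      (nhds (log (√(1 + √2)) / 4 / c)) := by
  set a := log (√(1 + √2)) with ha
  have hlog : Tendsto (fun n : ℕ => log (n : ℝ)) atTop atTop :=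
    tendsto_log_atTop.comp tendsto_natCast_atTop_atTop
  have hinv (b : ℝ) : Tendsto (fun n : ℕ => b / log (n : ℝ)) atTop (nhds 0) :=
    hlog.const_div_atTop b
  have hmain : Tendsto (fun n : ℕ => a / 4 / c * (1 - log c / log (n : ℝ))) atTop
      (nhds (a / 4 / c)) := by
    simpa using ((hinv (log c)).const_sub 1).const_mul (a / 4 / c)
  have herr := hinv ((4 + a / 2) / c)
  refine (tendsto_of_tendsto_of_dist hmain ?_)
  refine squeeze_zero' (Eventually.of_forall fun _ => dist_nonneg) ?_ herr
  filter_upwards [hlog.eventually_gt_atTop 0,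
    tendsto_natCast_atTop_atTop.eventually_ge_atTop (max c 1)] with n hl hn
  have hn1 : (1 : ℝ) ≤ n := (le_max_right _ _).trans hn
  have hn0 : (0 : ℝ) < n := by linarith
  have h := abs_tripleCount_sub_le ((one_le_div hc).mpr ((le_max_left _ _).trans hn))
  rw [log_div hn0.ne' hc.ne', ← ha] at h
  rw [dist_comm, Real.dist_eq]
  have e : tripleCount ((n : ℝ) / c) / (n * log n) - a / 4 / c * (1 - log c / log n) =
      (tripleCount ((n : ℝ) / c) - a / 4 * (n / c * (log n - log c))) / (n * log n) := by
    field_simp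
  rw [e, abs_div, abs_of_pos (show 0 < (n : ℝ) * log n by positivity),
    div_le_iff₀ (by positivity)]
  refine h.trans (le_of_eq ?_)
  field_simp

theorem tripleCount_div_le {c : ℝ} {n : ℕ} (hc : 1 ≤ c) (hn : 1 ≤ log n) :
    tripleCount ((n : ℝ) / c) / (n * log n) ≤ (4 + log (√(1 + √2))) * (1 / c) := by
  set a := log (√(1 + √2)) with ha
  have ha0 : 0 < a := log_sqrt_one_add_sqrt_two_pos
  have hc0 : 0 < c := by linarith
  have hn0 : (0 : ℝ) < n := by
    rcases Nat.eq_zero_or_pos n with rfl | h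
    · norm_num at hn
    · exact_mod_cast h
  rcases lt_or_ge ((n : ℝ) / c) 1 with h | h
  · rw [tripleCount_eq_zero h, zero_div]
    positivity
  · have h1 := (abs_le.mp (abs_tripleCount_sub_le h)).2
    have h2 : log ((n : ℝ) / c) ≤ log n :=
      log_le_log (by linarith) (div_le_self hn0.le hc)
    rw [div_le_iff₀ (by positivity)]
    have h3 : (n : ℝ) / c * log (n / c) ≤ n / c * log n := by gcongr
    have h4 : (n : ℝ) / c ≤ n / c * log n := le_mul_of_one_le_right (by positivity) hn
    have h5 : a / 4 * ((n : ℝ) / c * log (n / c)) ≤ a / 4 * (n / c * log n) := by gcongr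
    have h6 : (4 + a / 2) * ((n : ℝ) / c) ≤ (4 + a / 2) * (n / c * log n) := by gcongr
    have h7 : 0 ≤ a / 4 * ((n : ℝ) / c * log n) := by positivity
    calc tripleCount ((n : ℝ) / c) ≤ (4 + a) * (n / c * log n) := by linarith
      _ = (4 + a) * (1 / c) * (n * log n) := by ring

/-- Let `α = artanh(√2 - 1) = log √(1 + √2)`, and let `D_n` be the set of triples
`(k, r, s)` of positive integers with `k` odd, `r > s`, `gcd(r, s) = 1`, `r` and `s` of
opposite parity, `k·(r² - s²) ≤ n`, and `2·k·r·s ≤ n`. Then `|D_n| ∼ (2α/π²)·n·log n`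
as `n → ∞`. -/
theorem statement17 :
    Tendsto (fun n : ℕ =>
        (({t : ℕ × ℕ × ℕ | 0 < t.1 ∧ Odd t.1 ∧ t.2.2 < t.2.1 ∧ 0 < t.2.2 ∧
            Nat.Coprime t.2.1 t.2.2 ∧ t.2.1 % 2 ≠ t.2.2 % 2 ∧
            t.1 * (t.2.1 ^ 2 - t.2.2 ^ 2) ≤ n ∧ 2 * t.1 * t.2.1 * t.2.2 ≤ n}.ncard : ℝ)) /
          (2 * Real.log (Real.sqrt (1 + Real.sqrt 2)) / π ^ 2 * ((n : ℝ) * Real.log n)))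
      atTop (nhds 1) := by
  simp only [ncard_eq_tsum]
  set a := log (√(1 + √2)) with ha
  have ha0 : 0 < a := log_sqrt_one_add_sqrt_two_pos
  have hpi := pi_ne_zero
  have hlim : Tendsto (fun n : ℕ => ∑' d : ℕ, if Odd d then (ArithmeticFunction.moebius d : ℝ) *
        (tripleCount ((n : ℝ) / (d : ℝ) ^ 2) / (n * log n)) else 0) atTop
      (nhds (∑' d : ℕ, if Odd d then
        (ArithmeticFunction.moebius d : ℝ) * (a / 4 / (d : ℝ) ^ 2) else 0)) := by
    refine tendsto_tsum_of_dominated_convergence (bound := fun d : ℕ => (4 + a) * (1 / (d : ℝ) ^ 2))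
      ((Real.summable_one_div_nat_pow.mpr one_lt_two).mul_left _) (fun d => ?_) ?_
    · split_ifs with hd
      · have hd0 : (0 : ℝ) < d := by exact_mod_cast hd.pos
        exact (tendsto_tripleCount_div (by positivity)).const_mul _
      · exact tendsto_const_nhds
    · filter_upwards [(tendsto_log_atTop.comp tendsto_natCast_atTop_atTop).eventually_ge_atTop 1]
        with n hn d
      simp only [Function.comp_apply] at hn
      split_ifs with hd
      · have hd1 : (1 : ℝ) ≤ (d : ℝ) ^ 2 := one_le_pow₀ (by exact_mod_cast hd.pos)
        have hnn : 0 ≤ tripleCount ((n : ℝ) / (d : ℝ) ^ 2) / (n * log n) :=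
          div_nonneg (tripleCount_nonneg _) (by positivity)
        have hmu : |(ArithmeticFunction.moebius d : ℝ)| ≤ 1 := by
          exact_mod_cast ArithmeticFunction.abs_moebius_le_one (n := d)
        rw [norm_mul, Real.norm_eq_abs, Real.norm_of_nonneg hnn]
        exact (mul_le_of_le_one_left hnn hmu).trans (tripleCount_div_le hd1 hn)
      · rw [norm_zero]
        positivity
  have hval : (∑' d : ℕ, if Odd d then
      (ArithmeticFunction.moebius d : ℝ) * (a / 4 / (d : ℝ) ^ 2) else 0) = 2 * a / π ^ 2 := by
    have : 2 * a / π ^ 2 = a / 4 * (8 / π ^ 2) := by ring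
    rw [this, ← tsum_odd_moebius_div_sq, ← tsum_mul_left]
    refine tsum_congr fun d => ?_
    split_ifs <;> ring
  rw [hval] at hlim
  have hne : 2 * a / π ^ 2 ≠ 0 := by positivity
  have h1 := hlim.div_const (2 * a / π ^ 2)
  rw [div_self hne] at h1
  refine h1.congr fun n => ?_
  rw [mul_comm (2 * a / π ^ 2), ← div_div]
  refine congrArg (· / (2 * a / π ^ 2)) ((tsum_congr fun d => ?_).trans tsum_div_const)
  split_ifs
  · rw [mul_div_assoc]
  · rw [zero_div]
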